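/- Let γ : [a,b] → X be an absolutely continuous curve in a metric space. Then the metric speed |γ̇|(t) = lim_{s→t} d(γ_s,γ_t)/|s−t| exists for Lebesgue-a.e. t ∈ [a,b], and the length of γ equals ∫_a^b |γ̇|(t) dt. -/

import Mathlib

open Filter Set Metric Topology
open scoped ENNReal NNReal

variable {X : Type*} [MetricSpace X]

/-- `γ` is absolutely continuous on `[a,b]`: there is `g ∈ L¹(a,b)` with
`d(γ_s,γ_t) ≤ ∫_s^t g` for all `a ≤ s ≤ t ≤ b`. -/
def IsACCurveOn (γ : ℝ → X) (a b : ℝ) : Prop :=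
  ∃ g : ℝ → ℝ, MeasureTheory.IntegrableOn g (Set.Icc a b) ∧
    ∀ s t : ℝ, a ≤ s → s ≤ t → t ≤ b →
      dist (γ s) (γ t) ≤ ∫ u in Set.Icc s t, g u

/-- The length of a curve `γ` on `[a,b]`: the supremum of the sums
`Σ d(γ_{tᵢ}, γ_{tᵢ₋₁})` over finite monotone partitions of `[a,b]`. -/
noncomputable def pathLength (γ : ℝ → X) (a b : ℝ) : ℝ≥0∞ :=
  ⨆ (n : ℕ) (t : Fin (n + 1) → ℝ) (_ : Monotone t) (_ : ∀ i, t i ∈ Set.Icc a b),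
    ∑ i : Fin n, edist (γ (t i.castSucc)) (γ (t i.succ))

section MetricSpeedAux

open MeasureTheory

lemma ms_tendsto_slope {f : ℝ → ℝ} {f' t : ℝ} (h : HasDerivAt f f' t) :
    Tendsto (fun s => |f s - f t| / |s - t|) (𝓝[≠] t) (𝓝 |f'|) := by
  have := (hasDerivAt_iff_tendsto_slope.1 h).abs
  refine this.congr fun s => ?_
  rw [slope_def_field, abs_div]

lemma ms_intInt {h : ℝ → ℝ} (hi : Integrable h) (s t : ℝ) : IntervalIntegrable h volume s t :=
  hi.intervalIntegrable

/-- symmetric form of the domination hypothesis -/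
lemma ms_dist_le {η : ℝ → X} {h : ℝ → ℝ} (hi : Integrable h)
    (hd : ∀ s t, s ≤ t → dist (η s) (η t) ≤ ∫ u in s..t, h u) (s t : ℝ) :
    dist (η s) (η t) ≤ |(∫ u in (0:ℝ)..s, h u) - ∫ u in (0:ℝ)..t, h u| := by
  rw [intervalIntegral.integral_interval_sub_left (ms_intInt hi _ _) (ms_intInt hi _ _)]
  rcases le_total s t with hst | hst
  · rw [intervalIntegral.integral_symm, abs_neg]
    exact (hd s t hst).trans (le_abs_self _)
  · rw [dist_comm]
    exact (hd t s hst).trans (le_abs_self _)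

lemma ms_core {η : ℝ → X} {h : ℝ → ℝ} (hi : Integrable h)
    (hd : ∀ s t, s ≤ t → dist (η s) (η t) ≤ ∫ u in s..t, h u) :
    ∃ v : ℝ → ℝ, Integrable v ∧ (∀ t, 0 ≤ v t) ∧
      (∀ s t, s ≤ t → dist (η s) (η t) ≤ ∫ u in s..t, v u) ∧
      ∀ᵐ t, Tendsto (fun s => dist (η s) (η t) / |s - t|) (𝓝[≠] t) (𝓝 (v t)) := by
  have hd' := ms_dist_le hi hd
  have hloc := LocallyIntegrable.ae_hasDerivAt_integral hi.locallyIntegrable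
  set G : ℝ → ℝ := fun x => ∫ u in (0:ℝ)..x, h u with hG
  have hGc : Continuous G := intervalIntegral.continuous_primitive (fun _ _ => ms_intInt hi _ _) 0
  have hηc : Continuous η := by
    rw [continuous_iff_continuousAt]
    intro t
    rw [ContinuousAt, tendsto_iff_dist_tendsto_zero]
    refine squeeze_zero (fun _ => dist_nonneg) (fun s => hd' s t) ?_
    have : Tendsto (fun s => |G s - G t|) (𝓝 t) (𝓝 |G t - G t|) :=
      ((hGc.tendsto t).sub_const _).abs
    simpa using this
  -- the dense sequence of points on the curve
  set x : ℕ → ℝ := TopologicalSpace.denseSeq ℝ with hx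
  have hxd : DenseRange x := TopologicalSpace.denseRange_denseSeq ℝ
  set φ : ℕ → ℝ → ℝ := fun n t => dist (η t) (η (x n)) with hφ
  have hφle : ∀ n s t, |φ n s - φ n t| ≤ dist (η s) (η t) := fun n s t =>
    abs_dist_sub_le _ _ _
  have hφac : ∀ n a b, AbsolutelyContinuousOnInterval (φ n) a b := by
    intro n a b
    have hGac : AbsolutelyContinuousOnInterval G a b := by
      have h1 := (ms_intInt hi (min a (min b 0))
        (max a (max b 0))).absolutelyContinuousOnInterval_intervalIntegral (c := 0)
        (by rw [uIcc_of_le (by grind)]; constructor <;> grind)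
      refine h1.mono ?_
      apply uIcc_subset_uIcc <;> rw [uIcc_of_le (by grind)] <;> constructor <;> grind
    refine squeeze_zero (fun E => Finset.sum_nonneg fun i _ => dist_nonneg) (fun E => ?_) hGac
    refine Finset.sum_le_sum fun i _ => ?_
    rw [Real.dist_eq, Real.dist_eq]
    exact (hφle n _ _).trans (hd' _ _)
  have hφd : ∀ᵐ t, ∀ n, DifferentiableAt ℝ (φ n) t := by
    rw [ae_all_iff]
    intro n
    have : ∀ᵐ t, ∀ k : ℕ, t ∈ uIcc (-(k:ℝ)) k → DifferentiableAt ℝ (φ n) t :=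
      ae_all_iff.2 fun k => (hφac n _ _).ae_differentiableAt
    filter_upwards [this] with t ht
    obtain ⟨k, hk⟩ := exists_nat_ge |t|
    refine ht k ?_
    rw [uIcc_of_le (by linarith [abs_nonneg t])]
    exact abs_le.1 hk
  set v : ℝ → ℝ := fun t => ⨆ n, |deriv (φ n) t| with hv
  have hvm : Measurable v := Measurable.iSup fun n => (measurable_deriv (φ n)).abs
  have hv0 : ∀ t, 0 ≤ v t := fun t => Real.iSup_nonneg fun n => abs_nonneg _
  have hbd : ∀ᵐ t, ∀ n, |deriv (φ n) t| ≤ |h t| := by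
    filter_upwards [hφd, hloc] with t h1 h2 n
    refine le_of_tendsto_of_tendsto (ms_tendsto_slope (h1 n).hasDerivAt)
      (ms_tendsto_slope (h2 0)) (Eventually.of_forall fun s => ?_)
    exact div_le_div_of_nonneg_right ((hφle n _ _).trans (hd' _ _)) (abs_nonneg _)
  have hvle : ∀ᵐ t, ∀ n, |deriv (φ n) t| ≤ v t := by
    filter_upwards [hbd] with t ht n
    exact le_ciSup (f := fun n => |deriv (φ n) t|) ⟨|h t|, by rintro _ ⟨m, rfl⟩; exact ht m⟩ n
  have hvi : Integrable v := by
    refine hi.mono hvm.aestronglyMeasurable ?_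
    filter_upwards [hbd] with t ht
    rw [Real.norm_eq_abs, Real.norm_eq_abs, abs_of_nonneg (hv0 t)]
    exact ciSup_le ht
  have hvd : ∀ s t, s ≤ t → dist (η s) (η t) ≤ ∫ u in s..t, v u := by
    intro s t hst
    have key : ∀ n, φ n t - φ n s ≤ ∫ u in s..t, v u := by
      intro n
      rw [← (hφac n s t).integral_deriv_eq_sub]
      refine intervalIntegral.integral_mono_ae hst (hφac n s t).intervalIntegrable_deriv
        (ms_intInt hvi _ _) ?_
      filter_upwards [hvle] with u hu
      exact (le_abs_self _).trans (hu n)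
    -- pass to the limit
    have hcl : IsClosed {y : ℝ | dist (η t) (η y) - dist (η s) (η y) ≤ ∫ u in s..t, v u} :=
      isClosed_le (by fun_prop) continuous_const
    have := hxd.induction_on (p := fun y => dist (η t) (η y) - dist (η s) (η y) ≤ ∫ u in s..t, v u)
      s hcl (fun n => key n)
    simpa [dist_comm] using this
  refine ⟨v, hvi, hv0, hvd, ?_⟩
  have hvd' := ms_dist_le hvi hvd
  filter_upwards [hφd, LocallyIntegrable.ae_hasDerivAt_integral hvi.locallyIntegrable] with t h1 h2
  have hup := ms_tendsto_slope (h2 0)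
  rw [abs_of_nonneg (hv0 t)] at hup
  refine tendsto_order.2 ⟨fun c hc => ?_, fun c hc => ?_⟩
  · obtain ⟨n, hn⟩ := exists_lt_of_lt_ciSup hc
    filter_upwards [(tendsto_order.1 (ms_tendsto_slope (h1 n).hasDerivAt)).1 c hn] with s hs
    refine hs.trans_le ?_
    gcongr
    exact hφle n _ _
  · filter_upwards [(tendsto_order.1 hup).2 c hc] with s hs
    refine lt_of_le_of_lt ?_ hs
    gcongr
    exact hvd' _ _

lemma ms_pathLength_eq (γ : ℝ → X) (a b : ℝ) (hab : a ≤ b) :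
    pathLength γ a b = eVariationOn γ (Icc a b) := by
  apply le_antisymm
  · refine iSup_le fun n => iSup_le fun t => iSup_le fun ht => iSup_le fun hm => ?_
    set u : ℕ → ℝ := fun i => t ⟨min i n, by omega⟩ with hu
    have hum : Monotone u := fun i j hij => ht (by
      rw [Fin.mk_le_mk]; exact min_le_min_right _ hij)
    have := eVariationOn.sum_le (f := γ) (n := n) hum (fun i => hm ⟨min i n, by omega⟩)
    refine le_trans (le_of_eq ?_) this
    rw [← Fin.sum_univ_eq_sum_range (fun i => edist (γ (u (i + 1))) (γ (u i)))]
    refine Finset.sum_congr rfl fun i _ => ?_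
    rw [edist_comm]
    have h1 : u (i + 1) = t i.succ := by
      simp only [hu]; congr 1; ext; simp
    have h2 : u i = t i.castSucc := by
      simp only [hu]; congr 1; ext; simp
    rw [h1, h2]
  · refine iSup_le ?_
    rintro ⟨n, u, hu, hm⟩
    refine le_iSup_of_le n (le_iSup_of_le (fun i => u i) (le_iSup_of_le (fun i j hij => hu hij)
      (le_iSup_of_le (fun i => hm i) ?_)))
    dsimp only
    rw [← Fin.sum_univ_eq_sum_range (fun i => edist (γ (u (i + 1))) (γ (u i)))]
    refine le_of_eq (Finset.sum_congr rfl fun i _ => ?_)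
    rw [edist_comm]
    simp

lemma ms_length {η : ℝ → X} {v : ℝ → ℝ} (hvi : Integrable v) (hv0 : ∀ t, 0 ≤ v t)
    (hd : ∀ s t, s ≤ t → dist (η s) (η t) ≤ ∫ u in s..t, v u)
    (hlim : ∀ᵐ t, Tendsto (fun s => dist (η s) (η t) / |s - t|) (𝓝[≠] t) (𝓝 (v t)))
    (a b : ℝ) (hab : a ≤ b) :
    eVariationOn η (Icc a b) = ENNReal.ofReal (∫ u in a..b, v u) := by
  set V : ℝ → ℝ := fun x => ∫ u in (0:ℝ)..x, v u with hV
  have hsub : ∀ s t, V t - V s = ∫ u in s..t, v u := fun s t =>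
    intervalIntegral.integral_interval_sub_left (ms_intInt hvi _ _) (ms_intInt hvi _ _)
  have hVm : Monotone V := fun s t hst => by
    have : 0 ≤ V t - V s := by
      rw [hsub]; exact intervalIntegral.integral_nonneg hst fun u _ => hv0 u
    linarith
  have hup : ∀ s t, s ≤ t → eVariationOn η (Icc s t) ≤ ENNReal.ofReal (∫ u in s..t, v u) := by
    intro s t hst
    have h1 := (hVm.monotoneOn univ).eVariationOn_eq (mem_univ s) (mem_univ t)
    rw [univ_inter, hsub] at h1
    rw [← h1]
    refine iSup_le ?_
    rintro ⟨n, u, hu, hm⟩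
    refine le_trans (Finset.sum_le_sum fun i _ => ?_) (eVariationOn.sum_le (n := n) hu hm)
    dsimp only
    rw [edist_comm, edist_dist, edist_dist, Real.dist_eq, hsub]
    exact ENNReal.ofReal_le_ofReal ((hd _ _ (hu (Nat.le_succ i))).trans (le_abs_self _))
  refine le_antisymm (hup a b hab) ?_
  have hbv : LocallyBoundedVariationOn η univ := by
    intro s t _ _
    rw [univ_inter]
    rcases le_total s t with hst | hst
    · exact ((hup s t hst).trans_lt ENNReal.ofReal_lt_top).ne
    · have hss : (Icc s t).Subsingleton := fun x hx y hy => by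
        linarith [hx.1, hx.2, hy.1, hy.2]
      rw [BoundedVariationOn, eVariationOn.subsingleton _ hss]
      simp
  set L : ℝ → ℝ := variationOnFromTo η univ a with hL
  have hLm : Monotone L := monotoneOn_univ.1 (variationOnFromTo.monotoneOn hbv (mem_univ a))
  have hLd : ∀ s t, s ≤ t → dist (η s) (η t) ≤ L t - L s := by
    intro s t hst
    rw [hL, variationOnFromTo.sub_right hbv (mem_univ _) (mem_univ _) (mem_univ _),
      variationOnFromTo.eq_of_le _ _ hst, dist_edist]
    refine ENNReal.toReal_mono (hbv s t (mem_univ _) (mem_univ _)) ?_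
    exact eVariationOn.edist_le _ (by simp [hst]) (by simp [hst])
  have hLd' : ∀ s t, dist (η s) (η t) ≤ |L s - L t| := by
    intro s t
    rcases le_total s t with hst | hst
    · rw [abs_sub_comm]; exact (hLd s t hst).trans (le_abs_self _)
    · rw [dist_comm]; exact (hLd t s hst).trans (le_abs_self _)
  have hvL : ∀ᵐ t, v t ≤ deriv L t := by
    filter_upwards [hlim, hLm.ae_differentiableAt] with t h1 h2
    have h3 := ms_tendsto_slope h2.hasDerivAt
    rw [abs_of_nonneg (hLm.deriv_nonneg)] at h3
    refine le_of_tendsto_of_tendsto h1 h3 (Eventually.of_forall fun s => ?_)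
    dsimp only
    gcongr
    exact hLd' s t
  have hint : ∫ u in a..b, v u ≤ L b - L a := by
    refine le_trans (intervalIntegral.integral_mono_ae hab (ms_intInt hvi _ _)
      (hLm.monotoneOn _).intervalIntegrable_deriv hvL) ?_
    have := (hLm.monotoneOn (uIcc a b)).intervalIntegral_deriv_mem_uIcc
    rw [uIcc_of_le (by linarith [hLm hab])] at this
    exact this.2
  refine (ENNReal.ofReal_le_ofReal hint).trans ?_
  rw [hL, variationOnFromTo.self, sub_zero, variationOnFromTo.eq_of_le _ _ hab, univ_inter]
  exact ENNReal.ofReal_toReal_le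

end MetricSpeedAux

/-- The metric speed of an absolutely continuous curve exists a.e. and the length of
the curve is the integral of the metric speed. -/
theorem metric_speed_exists_ae (γ : ℝ → X) (a b : ℝ) (hab : a ≤ b)
    (hγ : IsACCurveOn γ a b) :
    ∃ v : ℝ → ℝ, (∀ᵐ t ∂(MeasureTheory.volume.restrict (Set.Icc a b)),
        Filter.Tendsto (fun s => dist (γ s) (γ t) / |s - t|) (𝓝[≠] t) (𝓝 (v t))) ∧
      pathLength γ a b = ∫⁻ t in Set.Icc a b, ENNReal.ofReal (v t) := by
  obtain ⟨g, hg, hgd⟩ := hγ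
  set η : ℝ → X := fun t => γ (max a (min b t)) with hη
  set h : ℝ → ℝ := (Icc a b).indicator (fun t => |g t|) with hh
  have hi : MeasureTheory.Integrable h :=
    (MeasureTheory.integrable_indicator_iff measurableSet_Icc).2 hg.abs
  have hηeq : EqOn η γ (Icc a b) := fun t ht => by
    simp only [hη]; rw [min_eq_right ht.2, max_eq_right ht.1]
  have h0 : ∀ t, 0 ≤ h t := fun t => indicator_nonneg (fun _ _ => abs_nonneg _) t
  have hd : ∀ s t, s ≤ t → dist (η s) (η t) ≤ ∫ u in s..t, h u := by
    intro s t hst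
    by_cases hb : b < s
    · have : η s = η t := by
        simp only [hη]; rw [min_eq_left hb.le, min_eq_left (by linarith)]
      rw [this, dist_self]
      exact intervalIntegral.integral_nonneg hst fun u _ => h0 u
    by_cases ha : t < a
    · have : η s = η t := by
        simp only [hη]
        rw [max_eq_left ((min_le_right _ _).trans (by linarith)),
          max_eq_left ((min_le_right _ _).trans (by linarith))]
      rw [this, dist_self]
      exact intervalIntegral.integral_nonneg hst fun u _ => h0 u
    push Not at ha hb
    set s' := max a (min b s) with hs'
    set t' := max a (min b t) with ht'
    have h1 : a ≤ s' := le_max_left _ _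
    have h2 : s' ≤ t' := max_le_max_left _ (min_le_min_left _ hst)
    have h3 : t' ≤ b := max_le hab (min_le_left _ _)
    have h4 : s ≤ s' := by rw [hs', min_eq_right hb]; exact le_max_right _ _
    have h5 : t' ≤ t := max_le ha (min_le_right _ _)
    refine (hgd s' t' h1 h2 h3).trans ?_
    rw [intervalIntegral.integral_of_le hst, ← MeasureTheory.integral_Icc_eq_integral_Ioc]
    have hsub : Icc s' t' ⊆ Icc a b := Icc_subset_Icc h1 h3
    calc ∫ u in Icc s' t', g u ≤ ∫ u in Icc s' t', h u := by
          refine MeasureTheory.setIntegral_mono_on (hg.mono_set hsub) hi.integrableOn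
            measurableSet_Icc fun u hu => ?_
          rw [hh, indicator_of_mem (hsub hu)]
          exact le_abs_self _
      _ ≤ ∫ u in Icc s t, h u :=
          MeasureTheory.setIntegral_mono_set hi.integrableOn
            (Eventually.of_forall fun u => h0 u) (Icc_subset_Icc h4 h5).eventuallyLE
  obtain ⟨v, hvi, hv0, hvd, hlim⟩ := ms_core hi hd
  refine ⟨v, ?_, ?_⟩
  · rw [← MeasureTheory.restrict_Ioo_eq_restrict_Icc]
    rw [MeasureTheory.ae_restrict_iff' measurableSet_Ioo]
    filter_upwards [hlim] with t ht htm
    refine ht.congr' ?_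
    filter_upwards [nhdsWithin_le_nhds (Icc_mem_nhds htm.1 htm.2)] with s hs
    rw [hηeq hs, hηeq (Ioo_subset_Icc_self htm)]
  · rw [ms_pathLength_eq γ a b hab, ← eVariationOn.eq_of_eqOn hηeq,
      ms_length hvi hv0 hvd hlim a b hab, intervalIntegral.integral_of_le hab,
      ← MeasureTheory.integral_Icc_eq_integral_Ioc,
      MeasureTheory.ofReal_integral_eq_lintegral_ofReal hvi.integrableOn
        (Eventually.of_forall fun u => hv0 u)]
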